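/- arXiv:2012.14098 — 8 statements merged into one kernel-verified Lean document; each statement's English description precedes it below -/
import Mathlib

section
/- Consider a finite Markov decision process with states S, actions A, reward r and transition kernel P. Let π and π* be policies, let ν* be a probability vector on S that is stationary for π*, and let ρ, η ∈ ℝ and Q, V, W, U : functions with V(s) = ∑_a π(s,a)·Q(s,a), U(s) = ∑_a π(s,a)·W(s,a), satisfying the Bellman equations Q(s,a) = r(s,a) − ρ + ∑_{s'} P(s,a,s')·V(s') and W(s,a) = r(s,a)² − η + ∑_{s'} P(s,a,s')·U(s') for all (s,a). Define ρ* = ∑_{s,a} ν*(s)·π*(s,a)·r(s,a) and η* = ∑_{s,a} ν*(s)·π*(s,a)·r(s,a)². Then for all λ, y ∈ ℝ, ((1+2λy)·ρ* − λ·η*) − ((1+2λy)·ρ − λ·η) = ∑_s ν*(s) · ∑_a ((1+2λy)·Q(s,a) − λ·W(s,a)) · (π*(s,a) − π(s,a)). -/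
open BigOperators

theorem pd_aux {S A : Type*} [Fintype S] [Fintype A]
    (f : S → A → ℝ) (P : S → A → S → ℝ) (π πstar : S → A → ℝ)
    (hπssum : ∀ s, ∑ a, πstar s a = 1)
    (ν : S → ℝ) (hνsum : ∑ s, ν s = 1)
    (hstat : ∀ s', ∑ s, ∑ a, ν s * πstar s a * P s a s' = ν s')
    (c : ℝ) (Q : S → A → ℝ) (V : S → ℝ)
    (hV : ∀ s, V s = ∑ a, π s a * Q s a)
    (hB : ∀ s a, Q s a = f s a - c + ∑ s', P s a s' * V s') :
    ∑ s, ν s * ∑ a, Q s a * (πstar s a - π s a)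
      = ∑ s, ∑ a, ν s * πstar s a * f s a - c := by
  have h1 : ∑ s, ∑ a, ν s * πstar s a * ∑ s', P s a s' * V s' = ∑ s, ν s * V s := by
    have : ∀ s', ν s' * V s' = ∑ s, ∑ a, ν s * πstar s a * (P s a s' * V s') := by
      intro s'
      rw [← hstat s', Finset.sum_mul]
      refine Finset.sum_congr rfl fun s _ => ?_
      rw [Finset.sum_mul]
      exact Finset.sum_congr rfl fun a _ => by ring
    simp_rw [this, Finset.mul_sum]
    rw [Finset.sum_comm]
    rw [Finset.sum_comm]
    simp_rw [fun s => Finset.sum_comm (s := (Finset.univ : Finset A))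
      (t := (Finset.univ : Finset S)) (f := fun a s' => ν s * πstar s a * (P s a s' * V s'))]
    rw [Finset.sum_comm]
  have h2 : ∑ s, ∑ a, ν s * πstar s a * c = c := by
    simp_rw [← Finset.sum_mul, ← Finset.mul_sum, hπssum, mul_one, hνsum, one_mul]
  have h3 : ∑ s, ∑ a, ν s * πstar s a * Q s a
      = ∑ s, ∑ a, ν s * πstar s a * f s a - c + ∑ s, ν s * V s := by
    rw [← h1]
    conv_rhs => rw [← h2]
    simp_rw [← Finset.sum_sub_distrib, ← Finset.sum_add_distrib]
    refine Finset.sum_congr rfl fun s _ => Finset.sum_congr rfl fun a _ => ?_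
    rw [hB s a]; ring
  have h4 : ∑ s, ν s * ∑ a, Q s a * (πstar s a - π s a)
      = ∑ s, ∑ a, ν s * πstar s a * Q s a - ∑ s, ν s * V s := by
    rw [← Finset.sum_sub_distrib]
    refine Finset.sum_congr rfl fun s _ => ?_
    rw [hV s, Finset.mul_sum, Finset.mul_sum, ← Finset.sum_sub_distrib]
    exact Finset.sum_congr rfl fun a _ => by ring
  rw [h4, h3]; ring

/-- Lemma 4.8 (performance difference for the Lagrangian): in a finite MDP, for
policies `π` and `π*` with `ν*` stationary for `π*`, and differential value
functions `Q, V, W, U` of `π` satisfying the Bellman equations for the reward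
and the squared reward, the Lagrangian difference equals the expectation under
`ν*` of the inner product of `(1+2λy)·Q − λ·W` with `π* − π`. -/
theorem stmt_2 {S A : Type*} [Fintype S] [Fintype A] [Nonempty S] [Nonempty A]
    (r : S → A → ℝ) (P : S → A → S → ℝ)
    (hPnn : ∀ s a s', 0 ≤ P s a s') (hPsum : ∀ s a, ∑ s', P s a s' = 1)
    (π πstar : S → A → ℝ)
    (hπnn : ∀ s a, 0 ≤ π s a) (hπsum : ∀ s, ∑ a, π s a = 1)
    (hπsnn : ∀ s a, 0 ≤ πstar s a) (hπssum : ∀ s, ∑ a, πstar s a = 1)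
    (νstar : S → ℝ) (hνnn : ∀ s, 0 ≤ νstar s) (hνsum : ∑ s, νstar s = 1)
    (hstat : ∀ s', ∑ s, ∑ a, νstar s * πstar s a * P s a s' = νstar s')
    (ρ η : ℝ) (Q W : S → A → ℝ) (V U : S → ℝ)
    (hV : ∀ s, V s = ∑ a, π s a * Q s a)
    (hU : ∀ s, U s = ∑ a, π s a * W s a)
    (hBellQ : ∀ s a, Q s a = r s a - ρ + ∑ s', P s a s' * V s')
    (hBellW : ∀ s a, W s a = (r s a) ^ 2 - η + ∑ s', P s a s' * U s')
    (ρstar ηstar : ℝ)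
    (hρstar : ρstar = ∑ s, ∑ a, νstar s * πstar s a * r s a)
    (hηstar : ηstar = ∑ s, ∑ a, νstar s * πstar s a * (r s a) ^ 2)
    (lam y : ℝ) :
    ((1 + 2 * lam * y) * ρstar - lam * ηstar)
        - ((1 + 2 * lam * y) * ρ - lam * η)
      = ∑ s, νstar s *
          ∑ a, ((1 + 2 * lam * y) * Q s a - lam * W s a) * (πstar s a - π s a) := by
  have hQ := pd_aux r P π πstar hπssum νstar hνsum hstat ρ Q V hV hBellQ
  have hW := pd_aux (fun s a => (r s a) ^ 2) P π πstar hπssum νstar hνsum hstat η W U hU hBellW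
  rw [← hρstar] at hQ
  simp only [← hηstar] at hW
  have h : ∑ s, νstar s *
          ∑ a, ((1 + 2 * lam * y) * Q s a - lam * W s a) * (πstar s a - π s a)
      = (1 + 2 * lam * y) * (∑ s, νstar s * ∑ a, Q s a * (πstar s a - π s a))
        - lam * (∑ s, νstar s * ∑ a, W s a * (πstar s a - π s a)) := by
    simp_rw [Finset.mul_sum, ← Finset.sum_sub_distrib]
    exact Finset.sum_congr rfl fun s _ => Finset.sum_congr rfl fun a _ => by ring
  rw [h, hQ, hW]; ring
end

section
/- Consider a finite Markov decision process with states S, actions A, reward r and transition kernel P. Let π and π* be policies, let ν* be a probability vector on S that is stationary for π*, and let ρ ∈ ℝ and Q, V satisfy V(s) = ∑_a π(s,a)·Q(s,a) and the Bellman equation Q(s,a) = r(s,a) − ρ + ∑_{s'} P(s,a,s')·V(s') for all (s,a). Define ρ* = ∑_{s,a} ν*(s)·π*(s,a)·r(s,a). Then ρ* − ρ = ∑_s ν*(s) · ∑_a Q(s,a)·(π*(s,a) − π(s,a)). -/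
open BigOperators

/-- Equation (C.4) (average-reward performance difference): in a finite MDP,
for policies `π` and `π*` with `ν*` stationary for `π*`, and the differential
Q-function of `π` satisfying the average-reward Bellman equation,
`ρ(π*) − ρ(π) = E_{ν*}[⟨Q(s,·), π*(·|s) − π(·|s)⟩]`. -/
theorem stmt_3 {S A : Type*} [Fintype S] [Fintype A] [Nonempty S] [Nonempty A]
    (r : S → A → ℝ) (P : S → A → S → ℝ)
    (hPnn : ∀ s a s', 0 ≤ P s a s') (hPsum : ∀ s a, ∑ s', P s a s' = 1)
    (π πstar : S → A → ℝ)
    (hπnn : ∀ s a, 0 ≤ π s a) (hπsum : ∀ s, ∑ a, π s a = 1)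
    (hπsnn : ∀ s a, 0 ≤ πstar s a) (hπssum : ∀ s, ∑ a, πstar s a = 1)
    (νstar : S → ℝ) (hνnn : ∀ s, 0 ≤ νstar s) (hνsum : ∑ s, νstar s = 1)
    (hstat : ∀ s', ∑ s, ∑ a, νstar s * πstar s a * P s a s' = νstar s')
    (ρ : ℝ) (Q : S → A → ℝ) (V : S → ℝ)
    (hV : ∀ s, V s = ∑ a, π s a * Q s a)
    (hBellQ : ∀ s a, Q s a = r s a - ρ + ∑ s', P s a s' * V s')
    (ρstar : ℝ)
    (hρstar : ρstar = ∑ s, ∑ a, νstar s * πstar s a * r s a) :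
    ρstar - ρ = ∑ s, νstar s * ∑ a, Q s a * (πstar s a - π s a) := by
  have h1 : ∑ s, ∑ a, νstar s * πstar s a * (∑ s', P s a s' * V s') = ∑ s', νstar s' * V s' := by
    have e : ∀ s', νstar s' * V s' = ∑ s, ∑ a, νstar s * πstar s a * P s a s' * V s' := by
      intro s'
      rw [← hstat s', Finset.sum_mul]
      exact Finset.sum_congr rfl fun s _ => Finset.sum_mul _ _ _
    simp only [e]
    rw [eq_comm, Finset.sum_comm]
    refine Finset.sum_congr rfl fun s _ => ?_
    rw [Finset.sum_comm]
    refine Finset.sum_congr rfl fun a _ => ?_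
    rw [Finset.mul_sum]
    exact Finset.sum_congr rfl fun s' _ => by ring
  have h2 : ∑ s, ∑ a, νstar s * πstar s a * ρ = ρ := by
    have e : ∀ s, ∑ a, νstar s * πstar s a * ρ = νstar s * ρ := by
      intro s
      rw [← Finset.sum_mul, ← Finset.mul_sum, hπssum, mul_one]
    simp only [e]
    rw [← Finset.sum_mul, hνsum, one_mul]
  have h3 : ∀ s, νstar s * ∑ a, Q s a * (πstar s a - π s a)
      = ∑ a, νstar s * πstar s a * r s a - ∑ a, νstar s * πstar s a * ρ
        + ∑ a, νstar s * πstar s a * (∑ s', P s a s' * V s') - νstar s * V s := by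
    intro s
    rw [hV s, Finset.mul_sum, Finset.mul_sum, ← Finset.sum_sub_distrib,
      ← Finset.sum_add_distrib, ← Finset.sum_sub_distrib]
    refine Finset.sum_congr rfl fun a _ => ?_
    have := hBellQ s a
    linear_combination (νstar s * πstar s a) * this
  simp only [h3]
  rw [Finset.sum_sub_distrib, Finset.sum_add_distrib,
    Finset.sum_sub_distrib, h1, h2, hρstar]
  ring
end

section
/- Consider a finite Markov decision process with states S, actions A, reward r and transition kernel P. Let π and π* be policies, let ν* be a probability vector on S that is stationary for π*, and let η ∈ ℝ and W, U satisfy U(s) = ∑_a π(s,a)·W(s,a) and the equation W(s,a) = r(s,a)² − η + ∑_{s'} P(s,a,s')·U(s') for all (s,a). Define η* = ∑_{s,a} ν*(s)·π*(s,a)·r(s,a)². Then η* − η = ∑_s ν*(s) · ∑_a W(s,a)·(π*(s,a) − π(s,a)). -/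
open BigOperators

/-- Equation (C.9) (squared-reward performance difference): in a finite MDP,
for policies `π` and `π*` with `ν*` stationary for `π*`, and the differential
W-function of `π` (the action-value function for the squared reward) satisfying
its Bellman equation, `η(π*) − η(π) = E_{ν*}[⟨W(s,·), π*(·|s) − π(·|s)⟩]`. -/
theorem stmt_4 {S A : Type*} [Fintype S] [Fintype A] [Nonempty S] [Nonempty A]
    (r : S → A → ℝ) (P : S → A → S → ℝ)
    (hPnn : ∀ s a s', 0 ≤ P s a s') (hPsum : ∀ s a, ∑ s', P s a s' = 1)
    (π πstar : S → A → ℝ)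
    (hπnn : ∀ s a, 0 ≤ π s a) (hπsum : ∀ s, ∑ a, π s a = 1)
    (hπsnn : ∀ s a, 0 ≤ πstar s a) (hπssum : ∀ s, ∑ a, πstar s a = 1)
    (νstar : S → ℝ) (hνnn : ∀ s, 0 ≤ νstar s) (hνsum : ∑ s, νstar s = 1)
    (hstat : ∀ s', ∑ s, ∑ a, νstar s * πstar s a * P s a s' = νstar s')
    (η : ℝ) (W : S → A → ℝ) (U : S → ℝ)
    (hU : ∀ s, U s = ∑ a, π s a * W s a)
    (hBellW : ∀ s a, W s a = (r s a) ^ 2 - η + ∑ s', P s a s' * U s')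
    (ηstar : ℝ)
    (hηstar : ηstar = ∑ s, ∑ a, νstar s * πstar s a * (r s a) ^ 2) :
    ηstar - η = ∑ s, νstar s * ∑ a, W s a * (πstar s a - π s a) := by
  have h1 : ∑ s, ∑ a, νstar s * πstar s a * (∑ s', P s a s' * U s') = ∑ s, νstar s * U s := by
    calc _ = ∑ s, ∑ a, ∑ s', νstar s * πstar s a * P s a s' * U s' := by
          simp only [Finset.mul_sum, mul_assoc]
      _ = ∑ s, ∑ s', ∑ a, νstar s * πstar s a * P s a s' * U s' :=
          Finset.sum_congr rfl fun s _ => Finset.sum_comm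
      _ = ∑ s', ∑ s, ∑ a, νstar s * πstar s a * P s a s' * U s' := Finset.sum_comm
      _ = _ := by
          refine Finset.sum_congr rfl fun s' _ => ?_
          rw [← hstat s']
          simp only [Finset.sum_mul]
  have h2 : ∑ s, ∑ a, νstar s * πstar s a * η = η := by
    simp only [← Finset.sum_mul, ← Finset.mul_sum, hπssum, mul_one, hνsum, one_mul]
  have h3 : ∀ s, νstar s * ∑ a, W s a * (πstar s a - π s a)
      = ∑ a, νstar s * πstar s a * W s a - νstar s * U s := by
    intro s
    rw [hU, Finset.mul_sum, Finset.mul_sum, ← Finset.sum_sub_distrib]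
    exact Finset.sum_congr rfl fun a _ => by ring
  have h4 : ∑ s, ∑ a, νstar s * πstar s a * W s a = ηstar - η + ∑ s, νstar s * U s := by
    rw [← h1, hηstar]
    nth_rewrite 1 [← h2]
    simp only [← Finset.sum_sub_distrib, ← Finset.sum_add_distrib]
    refine Finset.sum_congr rfl fun s _ => Finset.sum_congr rfl fun a _ => ?_
    rw [hBellW s a]
    ring
  rw [Finset.sum_congr rfl fun s _ => h3 s, Finset.sum_sub_distrib, h4]
  ring
end

section
/- Let M, N, γ > 0, α > 0, c, d ≥ 0, and let ρ, ρ̄, η, η̄ ∈ ℝ satisfy |ρ| ≤ M, |ρ̄| ≤ M, |η̄| ≤ M², |ρ − ρ̄| ≤ c, |η − η̄| ≤ d. Set ȳ = ρ̄. Let λ*, λ̄ ∈ [0, N] and define the projected gradient update λ̄' = min(N, max(0, λ̄ − (1/(2γ))·(α + 2ȳ·ρ̄ − η̄ − ȳ²))). Define L(λ) = (1+2λȳ)·ρ − λ·η − λ·ȳ² + λ·α. Then (λ* − λ̄)² − (λ* − λ̄')² ≥ −(1/γ)·(L(λ*) − L(λ̄)) − (2N/γ)·(d + 2M·c) − (1/(4γ²))·(α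 + 4M²)². -/
open BigOperators

/-- Lemma 4.9 (one-step descent of the Lagrange multiplier): the projected
gradient update of the multiplier, using estimated quantities `ρ̄, η̄` with
errors `c, d` and dual variable `ȳ = ρ̄`, satisfies the one-step descent
inequality with respect to the Lagrangian `L(λ) = (1+2λȳ)ρ − λη − λȳ² + λα`. -/
theorem stmt_5 (M N γ α c d ρ ρbar η ηbar ybar : ℝ)
    (hM : 0 < M) (hN : 0 < N) (hγ : 0 < γ) (hα : 0 < α)
    (hc : 0 ≤ c) (hd : 0 ≤ d)
    (hρ : |ρ| ≤ M) (hρbar : |ρbar| ≤ M) (hηbar : |ηbar| ≤ M ^ 2)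
    (hρc : |ρ - ρbar| ≤ c) (hηd : |η - ηbar| ≤ d)
    (hybar : ybar = ρbar)
    (lamStar lamBar lamBar' : ℝ)
    (hlamStar : lamStar ∈ Set.Icc (0 : ℝ) N) (hlamBar : lamBar ∈ Set.Icc (0 : ℝ) N)
    (hlamBar' : lamBar' = min N (max 0
      (lamBar - (1 / (2 * γ)) * (α + 2 * ybar * ρbar - ηbar - ybar ^ 2))))
    (L : ℝ → ℝ)
    (hL : ∀ l, L l = (1 + 2 * l * ybar) * ρ - l * η - l * ybar ^ 2 + l * α) :
    (lamStar - lamBar) ^ 2 - (lamStar - lamBar') ^ 2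
      ≥ -(1 / γ) * (L lamStar - L lamBar) - (2 * N / γ) * (d + 2 * M * c)
        - (1 / (4 * γ ^ 2)) * (α + 4 * M ^ 2) ^ 2 := by
  subst hybar
  obtain ⟨hs0, hsN⟩ := hlamStar
  obtain ⟨hb0, hbN⟩ := hlamBar
  have h1 : 1 / γ = 2 * (1 / (2 * γ)) := by field_simp
  have h2 : 2 * N / γ = 4 * N * (1 / (2 * γ)) := by field_simp; norm_num
  have h3 : 1 / (4 * γ ^ 2) = (1 / (2 * γ)) ^ 2 := by field_simp; norm_num
  have ht : 0 < 1 / (2 * γ) := by positivity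
  rw [h1, h2, h3, hL, hL]
  generalize 1 / (2 * γ) = t at *
  obtain ⟨g, hg⟩ : ∃ g, g = α + 2 * ybar * ybar - ηbar - ybar ^ 2 := ⟨_, rfl⟩
  rw [← hg] at hlamBar'
  have hproj : (lamStar - lamBar') ^ 2 ≤ (lamStar - (lamBar - t * g)) ^ 2 := by
    rw [hlamBar']
    generalize lamBar - t * g = x
    rcases le_total x 0 with hx | hx
    · rw [max_eq_left hx, min_eq_right hN.le]
      nlinarith
    · rw [max_eq_right hx]
      rcases le_total N x with h | h
      · rw [min_eq_left h]
        nlinarith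
      · rw [min_eq_right h]
  have hy2 : ybar ^ 2 ≤ M ^ 2 := sq_le_sq' (abs_le.mp hρbar).1 (abs_le.mp hρbar).2
  have hgs : g ^ 2 ≤ (α + 4 * M ^ 2) ^ 2 := by
    have := abs_le.mp hηbar
    apply sq_le_sq' <;> nlinarith [sq_nonneg ybar, sq_nonneg M]
  have hgt : t ^ 2 * g ^ 2 ≤ t ^ 2 * (α + 4 * M ^ 2) ^ 2 :=
    mul_le_mul_of_nonneg_left hgs (sq_nonneg t)
  have he : |2 * (ybar * (ρ - ybar)) - (η - ηbar)| ≤ d + 2 * M * c := by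
    have h : |ybar * (ρ - ybar)| ≤ M * c := by
      rw [abs_mul]
      exact mul_le_mul hρbar hρc (abs_nonneg _) hM.le
    have h' := abs_le.mp h
    have h'' := abs_le.mp hηd
    rw [abs_le]
    constructor <;> linarith
  have hsb : |lamStar - lamBar| ≤ N := by
    rw [abs_le]
    constructor <;> linarith
  have hp : |(lamStar - lamBar) * (2 * (ybar * (ρ - ybar)) - (η - ηbar))|
      ≤ N * (d + 2 * M * c) := by
    rw [abs_mul]
    exact mul_le_mul hsb he (abs_nonneg _) hN.le
  have hE : 0 ≤ N * (d + 2 * M * c) := by positivity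
  have hp1 := (abs_le.mp hp).1
  have hfin : 0 ≤ t * ((lamStar - lamBar) * (2 * (ybar * (ρ - ybar)) - (η - ηbar))
      + 2 * (N * (d + 2 * M * c))) := mul_nonneg ht.le (by linarith)
  subst hg
  nlinarith
end

section
/- Let A be a nonempty finite type, let τ, τ', β > 0, let f, f', Q, W : A → ℝ, and let λ̄, ȳ, y* ∈ ℝ. Define the softmax probability vectors π_k = softmax(τ⁻¹·f), π' = softmax(τ'⁻¹·f'), and π₊ = softmax(β⁻¹·(1+2λ̄ȳ)·Q − β⁻¹·λ̄·W + τ⁻¹·f). Then for every probability vector π* on A: KL(π*‖π') − KL(π*‖π_k) ≤ ∑_a log(π'(a)/π₊(a))·(π_k(a) − π*(a)) − β⁻¹·∑_a ((1+2y*λ̄)·Q(a) − λ̄·W(a))·(π*(a) − π_k(a)) + β⁻¹·∑_a 2(y* − ȳ)·λ̄·Q(a)·(π*(a) − π_k(a)) − ∑_a (τ'⁻¹·f'(a) − τ⁻¹·f(a))·(π_k(a) − π'(a)) − (1/2)·(∑_a |π'(a) − π_k(a)|)². -/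
open BigOperators

/-- The softmax distribution on a finite type with energy `g`. -/
noncomputable def softmax {A : Type*} [Fintype A] (g : A → ℝ) : A → ℝ :=
  fun a => Real.exp (g a) / ∑ a', Real.exp (g a')

lemma aux_deriv (x : ℝ) (hx : 0 < x) :
    HasDerivAt (fun x : ℝ => Real.log x - (5*x^2-4*x-1)/(2*x^2+4*x))
      ((x-1)^3/(x^2*(x+2)^2)) x := by
  have hD : 2*x^2+4*x ≠ 0 := by positivity
  have h1 : HasDerivAt (fun x : ℝ => 5*x^2-4*x-1) (10*x-4) x := by
    have := (((hasDerivAt_pow 2 x).const_mul 5).sub ((hasDerivAt_id x).const_mul 4)).sub_const 1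
    refine this.congr_deriv ?_
    norm_num
    try ring
  have h2 : HasDerivAt (fun x : ℝ => 2*x^2+4*x) (4*x+4) x := by
    have := (((hasDerivAt_pow 2 x).const_mul 2).add ((hasDerivAt_id x).const_mul 4))
    refine this.congr_deriv ?_
    norm_num
    try ring
  have := (Real.hasDerivAt_log hx.ne').sub (h1.div h2 hD)
  refine this.congr_deriv ?_
  have : x + 2 ≠ 0 := by positivity
  have e : 2*x^2+4*x = 2*x*(x+2) := by ring
  rw [e]
  field_simp
  ring

lemma aux_log (x : ℝ) (hx : 0 < x) : (5*x^2-4*x-1)/(2*x^2+4*x) ≤ Real.log x := by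
  set G : ℝ → ℝ := fun x : ℝ => Real.log x - (5*x^2-4*x-1)/(2*x^2+4*x) with hG
  have hG1 : G 1 = 0 := by norm_num [hG]
  suffices h : G 1 ≤ G x by
    rw [hG1] at h
    exact sub_nonneg.mp h
  rcases le_total 1 x with h | h
  · have hm : MonotoneOn G (Set.Ici 1) := by
      apply monotoneOn_of_deriv_nonneg (convex_Ici 1)
      · intro y hy
        exact (aux_deriv y (lt_of_lt_of_le one_pos hy)).continuousAt.continuousWithinAt
      · intro y hy
        rw [interior_Ici] at hy
        exact (aux_deriv y (lt_trans one_pos hy)).differentiableAt.differentiableWithinAt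
      · intro y hy
        rw [interior_Ici] at hy
        have hy' : 1 < y := hy
        rw [(aux_deriv y (lt_trans one_pos hy)).deriv]
        have : 0 ≤ y - 1 := by linarith
        positivity
    exact hm (Set.mem_Ici.mpr le_rfl) h h
  · have hm : AntitoneOn G (Set.Icc x 1) := by
      apply antitoneOn_of_deriv_nonpos (convex_Icc x 1)
      · intro y hy
        exact (aux_deriv y (lt_of_lt_of_le hx hy.1)).continuousAt.continuousWithinAt
      · intro y hy
        rw [interior_Icc] at hy
        exact (aux_deriv y (lt_trans hx hy.1)).differentiableAt.differentiableWithinAt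
      · intro y hy
        rw [interior_Icc] at hy
        rw [(aux_deriv y (lt_trans hx hy.1)).deriv]
        have h1 : 0 ≤ 1 - y := by linarith [hy.2]
        have h3 : (y-1)^3 ≤ 0 := by
          have := pow_nonneg h1 3
          nlinarith
        exact div_nonpos_of_nonpos_of_nonneg h3 (by positivity)
    exact hm (Set.left_mem_Icc.mpr h) (Set.right_mem_Icc.mpr h) h

lemma aux_pt (p q : ℝ) (hp : 0 < p) (hq : 0 < q) :
    3/2 * (|p-q|^2/(p+2*q)) ≤ p * Real.log (p/q) - p + q := by
  have h := mul_le_mul_of_nonneg_left (aux_log (p/q) (div_pos hp hq)) hp.le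
  have e : p * ((5*(p/q)^2-4*(p/q)-1)/(2*(p/q)^2+4*(p/q))) = 3/2 * (|p-q|^2/(p+2*q)) + p - q := by
    rw [sq_abs]
    have : p + 2*q ≠ 0 := by positivity
    have e : 2*(p/q)^2+4*(p/q) = 2*p*(p+2*q)/q^2 := by
      field_simp
      ring
    rw [e]
    field_simp
    ring
  linarith

lemma aux_pinsker {A : Type*} [Fintype A] (p q : A → ℝ) (hp : ∀ a, 0 < p a) (hq : ∀ a, 0 < q a)
    (sp : ∑ a, p a = 1) (sq : ∑ a, q a = 1) :
    1/2 * (∑ a, |p a - q a|)^2 ≤ ∑ a, p a * Real.log (p a / q a) := by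
  have h1 := Finset.sum_le_sum (fun a (_ : a ∈ Finset.univ) => aux_pt (p a) (q a) (hp a) (hq a))
  have h2 := Finset.sq_sum_div_le_sum_sq_div Finset.univ (fun a => |p a - q a|)
    (g := fun a => p a + 2 * q a) (fun a _ => by have := hp a; have := hq a; positivity)
  rw [← Finset.mul_sum] at h1
  simp only [Finset.sum_add_distrib, Finset.sum_sub_distrib, ← Finset.mul_sum, sp, sq] at h1 h2
  linarith

lemma softmax_pos' {A : Type*} [Fintype A] [Nonempty A] (g : A → ℝ) (a : A) : 0 < softmax g a :=
  div_pos (Real.exp_pos _) (Finset.sum_pos (fun _ _ => Real.exp_pos _) Finset.univ_nonempty)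

lemma softmax_sum' {A : Type*} [Fintype A] [Nonempty A] (g : A → ℝ) : ∑ a, softmax g a = 1 := by
  unfold softmax
  rw [← Finset.sum_div]
  exact div_self (Finset.sum_pos (fun _ _ => Real.exp_pos _) Finset.univ_nonempty).ne'

lemma softmax_log' {A : Type*} [Fintype A] [Nonempty A] (g : A → ℝ) :
    ∃ Z : ℝ, ∀ a, Real.log (softmax g a) = g a - Z := by
  refine ⟨Real.log (∑ a', Real.exp (g a')), fun a => ?_⟩
  unfold softmax
  rw [Real.log_div (Real.exp_pos _).ne'
    (Finset.sum_pos (fun _ _ => Real.exp_pos _) Finset.univ_nonempty).ne', Real.log_exp]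

/-- Lemma 4.10 (per-state one-step descent of the policy): for the current
energy-based policy `πk`, the new parameterized policy `π'`, and the ideal
improved policy `π₊`, the change of KL divergence to any probability vector
`π*` decomposes as stated, with the last term coming from Pinsker's
inequality. Here `KL(p‖q) = ∑ p a · log(p a / q a)`. -/
theorem stmt_6 {A : Type*} [Fintype A] [Nonempty A]
    (τ τ' β : ℝ) (hτ : 0 < τ) (hτ' : 0 < τ') (hβ : 0 < β)
    (f f' Q W : A → ℝ) (lamBar ybar ystar : ℝ)
    (πk π' πplus : A → ℝ)
    (hπk : πk = softmax (fun a => τ⁻¹ * f a))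
    (hπ' : π' = softmax (fun a => τ'⁻¹ * f' a))
    (hπplus : πplus = softmax (fun a =>
      β⁻¹ * (1 + 2 * lamBar * ybar) * Q a - β⁻¹ * lamBar * W a + τ⁻¹ * f a))
    (πstar : A → ℝ) (hπstarnn : ∀ a, 0 ≤ πstar a) (hπstarsum : ∑ a, πstar a = 1) :
    (∑ a, πstar a * Real.log (πstar a / π' a))
        - (∑ a, πstar a * Real.log (πstar a / πk a))
      ≤ (∑ a, Real.log (π' a / πplus a) * (πk a - πstar a))
        - β⁻¹ * ∑ a, ((1 + 2 * ystar * lamBar) * Q a - lamBar * W a)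
            * (πstar a - πk a)
        + β⁻¹ * ∑ a, 2 * (ystar - ybar) * lamBar * Q a * (πstar a - πk a)
        - (∑ a, (τ'⁻¹ * f' a - τ⁻¹ * f a) * (πk a - π' a))
        - (1 / 2) * (∑ a, |π' a - πk a|) ^ 2 := by
  have pk : ∀ a, 0 < πk a := fun a => hπk ▸ softmax_pos' _ a
  have p' : ∀ a, 0 < π' a := fun a => hπ' ▸ softmax_pos' _ a
  have pp : ∀ a, 0 < πplus a := fun a => hπplus ▸ softmax_pos' _ a
  have sk : ∑ a, πk a = 1 := hπk ▸ softmax_sum' _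
  have s' : ∑ a, π' a = 1 := hπ' ▸ softmax_sum' _
  obtain ⟨Zk, lk⟩ := softmax_log' (fun a => τ⁻¹ * f a)
  obtain ⟨Z', l'⟩ := softmax_log' (fun a => τ'⁻¹ * f' a)
  obtain ⟨Zp, lp⟩ := softmax_log' (fun a =>
      β⁻¹ * (1 + 2 * lamBar * ybar) * Q a - β⁻¹ * lamBar * W a + τ⁻¹ * f a)
  rw [← hπk] at lk
  rw [← hπ'] at l'
  rw [← hπplus] at lp
  have hP := aux_pinsker π' πk p' pk s' sk
  have key : (∑ a, πstar a * Real.log (πstar a / π' a))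
        - (∑ a, πstar a * Real.log (πstar a / πk a))
      = (∑ a, Real.log (π' a / πplus a) * (πk a - πstar a))
        - β⁻¹ * ∑ a, ((1 + 2 * ystar * lamBar) * Q a - lamBar * W a)
            * (πstar a - πk a)
        + β⁻¹ * ∑ a, 2 * (ystar - ybar) * lamBar * Q a * (πstar a - πk a)
        - (∑ a, (τ'⁻¹ * f' a - τ⁻¹ * f a) * (πk a - π' a))
        - (∑ a, π' a * Real.log (π' a / πk a))
        + (Z' - Zp) * (∑ a, πk a - ∑ a, πstar a) + (Z' - Zk) * (∑ a, πstar a - ∑ a, π' a) := by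
    simp only [Finset.mul_sum, ← Finset.sum_sub_distrib, ← Finset.sum_add_distrib]
    refine Finset.sum_congr rfl fun a _ => ?_
    rw [Real.log_div (p' a).ne' (pp a).ne', Real.log_div (p' a).ne' (pk a).ne']
    have e : πstar a * Real.log (πstar a / π' a) - πstar a * Real.log (πstar a / πk a)
        = πstar a * (Real.log (πk a) - Real.log (π' a)) := by
      rcases (hπstarnn a).eq_or_lt with h | h
      · rw [← h]; ring
      · rw [Real.log_div h.ne' (p' a).ne', Real.log_div h.ne' (pk a).ne']; ring
    rw [e, lk, l', lp]
    ring
  rw [key, sk, s', hπstarsum]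
  linarith
end

section
/- Let M, N > 0, c ≥ 0, and let ρ, η, α ∈ ℝ. Let λ̄ ∈ [0, N], and let y*, ȳ ∈ ℝ with |y*| ≤ M, |ȳ| ≤ M, and |ρ − ȳ| ≤ c. Define L(y) = (1+2λ̄y)·ρ − λ̄·η − λ̄·y² + λ̄·α. Then L(y*) − L(ȳ) ≤ 4·M·N·c. -/
/-- Lemma 4.11: the gap in the Lagrangian `L(y) = (1+2λ̄y)ρ − λ̄η − λ̄y² + λ̄α`
between the optimal dual variable `y*` and the estimated dual variable `ȳ`
(with `|ρ − ȳ| ≤ c`) is at most `4MNc`. -/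
theorem stmt_7 (M N c ρ η α : ℝ) (hM : 0 < M) (hN : 0 < N) (hc : 0 ≤ c)
    (lamBar : ℝ) (hlamBar : lamBar ∈ Set.Icc (0 : ℝ) N)
    (ystar ybar : ℝ) (hystar : |ystar| ≤ M) (hybar : |ybar| ≤ M)
    (hρy : |ρ - ybar| ≤ c)
    (L : ℝ → ℝ)
    (hL : ∀ y, L y = (1 + 2 * lamBar * y) * ρ - lamBar * η
      - lamBar * y ^ 2 + lamBar * α) :
    L ystar - L ybar ≤ 4 * M * N * c := by
  obtain ⟨h0, h1⟩ := hlamBar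
  have hd : |ystar - ybar| ≤ 2 * M := by
    rw [abs_le] at *
    constructor <;> linarith
  have hp : (ystar - ybar) * (ρ - ybar) ≤ 2 * M * c := by
    calc (ystar - ybar) * (ρ - ybar) ≤ |(ystar - ybar) * (ρ - ybar)| := le_abs_self _
      _ = |ystar - ybar| * |ρ - ybar| := abs_mul _ _
      _ ≤ 2 * M * c := mul_le_mul hd hρy (abs_nonneg _) (by positivity)
  have h2 : lamBar * ((ystar - ybar) * (ρ - ybar)) ≤ lamBar * (2 * M * c) :=
    mul_le_mul_of_nonneg_left hp h0
  have h3 : lamBar * (2 * M * c) ≤ N * (2 * M * c) :=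
    mul_le_mul_of_nonneg_right h1 (by positivity)
  have h4 : 0 ≤ lamBar * (ystar - ybar) ^ 2 := by positivity
  rw [hL, hL]
  linarith
end

section
/- Let S, A be nonempty finite types. Let ν*, ν_k be probability vectors on S with ν_k strictly positive; let π₀, π*, π_k be policies on (S,A) with π₀ and π_k strictly positive; define σ_k(s,a) = ν_k(s)·π_k(s,a), σ*(s,a) = ν*(s)·π*(s,a), and μ₀(s,a) = ν*(s)·π₀(s,a). Let τ_k, τ', β > 0, M, N > 0, λ̄ ∈ [0,N], ȳ ∈ ℝ with |ȳ| ≤ M. Let f, f', Q_q, W_ω, Q, W : S → A → ℝ, and suppose for every s: π_k(s,·) = softmax(τ_k⁻¹·f(s,·)), π'(s,·) = softmax(τ'⁻¹·f'(s,·)), and π₊(s,·) = softmax(β⁻¹·(1+2λ̄ȳ)·Q(s,·) − β⁻¹·λ̄·W(s,·) + τ_k⁻¹·f(s,·)). Assume the error bounds ∑_{s,a} μ₀(s,a)·(f'(s,a) − τ'·(β⁻¹·(1+2λ̄ȳ)·Q_q(s,a) − β⁻¹·λ̄·W_ω(s,a) + τ_k⁻¹·f(s,a)))² ≤ ε₁²,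 ∑_{s,a} σ_k(s,a)·(Q_q(s,a) − Q(s,a))² ≤ ε₂², and ∑_{s,a} σ_k(s,a)·(W_ω(s,a) − W(s,a))² ≤ ε₃², with ε₁, ε₂, ε₃ ≥ 0. Define φ* = (∑_{s,a} μ₀(s,a)·(π*(s,a)/π₀(s,a) − π_k(s,a)/π₀(s,a))²)^{1/2} and ψ* = (∑_{s,a} σ_k(s,a)·(σ*(s,a)/σ_k(s,a) − ν*(s)/ν_k(s))²)^{1/2}. Then |∑_s ν*(s)·∑_a log(π'(s,a)/π₊(s,a))·(π*(s,a) − π_k(s,a))| ≤ τ'⁻¹·ε₁·φ* + (1+2MN)·β⁻¹·ε₂·ψ* + N·β⁻¹·ε₃·ψ*. -/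
open BigOperators

theorem cs_aux {S A : Type*} [Fintype S] [Fintype A] (w x y : S → A → ℝ) (ε : ℝ)
    (hε : 0 ≤ ε) (hw : ∀ s a, 0 ≤ w s a) (hx : ∑ s, ∑ a, w s a * x s a ^ 2 ≤ ε ^ 2) :
    |∑ s, ∑ a, w s a * x s a * y s a| ≤ ε * Real.sqrt (∑ s, ∑ a, w s a * y s a ^ 2) := by
  have h0 : 0 ≤ ∑ s, ∑ a, w s a * y s a ^ 2 :=
    Finset.sum_nonneg fun s _ => Finset.sum_nonneg fun a _ => mul_nonneg (hw s a) (sq_nonneg _)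
  apply abs_le_of_sq_le_sq _ (by positivity)
  rw [mul_pow, Real.sq_sqrt h0]
  refine le_trans ?_ (mul_le_mul_of_nonneg_right hx h0)
  simp only [← Finset.sum_product']
  have h := Finset.sum_mul_sq_le_sq_mul_sq (Finset.univ ×ˢ Finset.univ : Finset (S × A))
    (fun p => Real.sqrt (w p.1 p.2) * x p.1 p.2) (fun p => Real.sqrt (w p.1 p.2) * y p.1 p.2)
  have e : ∀ p : S × A, Real.sqrt (w p.1 p.2) * x p.1 p.2 * (Real.sqrt (w p.1 p.2) * y p.1 p.2)
      = w p.1 p.2 * x p.1 p.2 * y p.1 p.2 := fun p => by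
    have := Real.mul_self_sqrt (hw p.1 p.2)
    linear_combination (x p.1 p.2 * y p.1 p.2) * this
  simpa only [e, mul_pow, Real.sq_sqrt (hw _ _)] using h

theorem log_softmax_aux {A : Type*} [Fintype A] [Nonempty A] (g h : A → ℝ) :
    ∃ c : ℝ, ∀ a, Real.log (softmax g a / softmax h a) = g a - h a + c := by
  have hp : ∀ g : A → ℝ, 0 < ∑ a, Real.exp (g a) := fun g =>
    Finset.sum_pos (fun a _ => Real.exp_pos _) Finset.univ_nonempty
  refine ⟨Real.log (∑ a, Real.exp (h a)) - Real.log (∑ a, Real.exp (g a)), fun a => ?_⟩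
  have h1 := hp g
  have h2 := hp h
  unfold softmax
  rw [Real.log_div (by positivity) (by positivity), Real.log_div (by positivity) (by positivity),
    Real.log_div (by positivity) (by positivity), Real.log_exp, Real.log_exp]
  ring

/-- Lemma 4.5 (error propagation), finite state-action setting: the actor
fitting error `ε₁` (in `L²(ν*⊗π₀)`) and the critic policy-evaluation errors
`ε₂, ε₃` (in `L²(σ_k)`) propagate into the expected log-ratio between the
fitted policy `π'` and the ideal improved policy `π₊`, weighted by the
density-ratio quantities `φ*` and `ψ*`. -/
theorem stmt_9 {S A : Type*} [Fintype S] [Fintype A] [Nonempty S] [Nonempty A]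
    (νstar νk : S → ℝ)
    (hνstarnn : ∀ s, 0 ≤ νstar s) (hνstarsum : ∑ s, νstar s = 1)
    (hνkpos : ∀ s, 0 < νk s) (hνksum : ∑ s, νk s = 1)
    (π₀ πstar πk : S → A → ℝ)
    (hπ₀pos : ∀ s a, 0 < π₀ s a) (hπ₀sum : ∀ s, ∑ a, π₀ s a = 1)
    (hπstarnn : ∀ s a, 0 ≤ πstar s a) (hπstarsum : ∀ s, ∑ a, πstar s a = 1)
    (hπkpos : ∀ s a, 0 < πk s a) (hπksum : ∀ s, ∑ a, πk s a = 1)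
    (σk σstar μ₀ : S → A → ℝ)
    (hσk : ∀ s a, σk s a = νk s * πk s a)
    (hσstar : ∀ s a, σstar s a = νstar s * πstar s a)
    (hμ₀ : ∀ s a, μ₀ s a = νstar s * π₀ s a)
    (τk τ' β M N : ℝ) (hτk : 0 < τk) (hτ' : 0 < τ') (hβ : 0 < β)
    (hM : 0 < M) (hN : 0 < N)
    (lamBar : ℝ) (hlamBar : lamBar ∈ Set.Icc (0 : ℝ) N)
    (ybar : ℝ) (hybar : |ybar| ≤ M)
    (f f' Qq Wω Q W : S → A → ℝ)
    (π' πplus : S → A → ℝ)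
    (hπk' : ∀ s, (fun a => πk s a) = softmax (fun a => τk⁻¹ * f s a))
    (hπ' : ∀ s, (fun a => π' s a) = softmax (fun a => τ'⁻¹ * f' s a))
    (hπplus : ∀ s, (fun a => πplus s a) = softmax (fun a =>
      β⁻¹ * (1 + 2 * lamBar * ybar) * Q s a - β⁻¹ * lamBar * W s a
        + τk⁻¹ * f s a))
    (ε₁ ε₂ ε₃ : ℝ) (hε₁ : 0 ≤ ε₁) (hε₂ : 0 ≤ ε₂) (hε₃ : 0 ≤ ε₃)
    (herr₁ : ∑ s, ∑ a, μ₀ s a *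
      (f' s a - τ' * (β⁻¹ * (1 + 2 * lamBar * ybar) * Qq s a
        - β⁻¹ * lamBar * Wω s a + τk⁻¹ * f s a)) ^ 2 ≤ ε₁ ^ 2)
    (herr₂ : ∑ s, ∑ a, σk s a * (Qq s a - Q s a) ^ 2 ≤ ε₂ ^ 2)
    (herr₃ : ∑ s, ∑ a, σk s a * (Wω s a - W s a) ^ 2 ≤ ε₃ ^ 2)
    (φstar ψstar : ℝ)
    (hφstar : φstar = Real.sqrt (∑ s, ∑ a, μ₀ s a *
      (πstar s a / π₀ s a - πk s a / π₀ s a) ^ 2))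
    (hψstar : ψstar = Real.sqrt (∑ s, ∑ a, σk s a *
      (σstar s a / σk s a - νstar s / νk s) ^ 2)) :
    |∑ s, νstar s * ∑ a, Real.log (π' s a / πplus s a) * (πstar s a - πk s a)|
      ≤ τ'⁻¹ * ε₁ * φstar + (1 + 2 * M * N) * β⁻¹ * ε₂ * ψstar
        + N * β⁻¹ * ε₃ * ψstar := by
  have hμnn : ∀ s a, 0 ≤ μ₀ s a := fun s a => by
    rw [hμ₀]; exact mul_nonneg (hνstarnn s) (hπ₀pos s a).le
  have hσpos : ∀ s a, 0 < σk s a := fun s a => by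
    rw [hσk]; exact mul_pos (hνkpos s) (hπkpos s a)
  have c1 := cs_aux μ₀ _ (fun s a => πstar s a / π₀ s a - πk s a / π₀ s a) ε₁ hε₁ hμnn herr₁
  have c2 := cs_aux σk _ (fun s a => σstar s a / σk s a - νstar s / νk s) ε₂ hε₂
    (fun s a => (hσpos s a).le) herr₂
  have c3 := cs_aux σk _ (fun s a => σstar s a / σk s a - νstar s / νk s) ε₃ hε₃
    (fun s a => (hσpos s a).le) herr₃
  rw [← hφstar] at c1
  rw [← hψstar] at c2 c3
  have hψ0 : 0 ≤ ψstar := hψstar ▸ Real.sqrt_nonneg _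
  have y1 : ∀ s a, μ₀ s a * (πstar s a / π₀ s a - πk s a / π₀ s a)
      = νstar s * (πstar s a - πk s a) := fun s a => by
    have := (hπ₀pos s a).ne'
    rw [hμ₀]; field_simp
  have y2 : ∀ s a, σk s a * (σstar s a / σk s a - νstar s / νk s)
      = νstar s * (πstar s a - πk s a) := fun s a => by
    have h1 := (hπkpos s a).ne'
    have h2 := (hνkpos s).ne'
    rw [hσk, hσstar]; field_simp
  have key : ∑ s, νstar s * ∑ a, Real.log (π' s a / πplus s a) * (πstar s a - πk s a)
      = τ'⁻¹ * (∑ s, ∑ a, μ₀ s a * (f' s a - τ' * (β⁻¹ * (1 + 2 * lamBar * ybar) * Qq s a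
          - β⁻¹ * lamBar * Wω s a + τk⁻¹ * f s a))
            * (πstar s a / π₀ s a - πk s a / π₀ s a))
        + (1 + 2 * lamBar * ybar) * β⁻¹ * (∑ s, ∑ a, σk s a * (Qq s a - Q s a)
            * (σstar s a / σk s a - νstar s / νk s))
        - lamBar * β⁻¹ * (∑ s, ∑ a, σk s a * (Wω s a - W s a)
            * (σstar s a / σk s a - νstar s / νk s)) := by
    simp only [Finset.mul_sum (s := (Finset.univ : Finset S)), ← Finset.sum_add_distrib,
      ← Finset.sum_sub_distrib]
    refine Finset.sum_congr rfl fun s _ => ?_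
    obtain ⟨c, hc⟩ := log_softmax_aux (fun a => τ'⁻¹ * f' s a) (fun a =>
      β⁻¹ * (1 + 2 * lamBar * ybar) * Q s a - β⁻¹ * lamBar * W s a + τk⁻¹ * f s a)
    rw [← hπ' s, ← hπplus s] at hc
    have hz : ∑ a, c * (νstar s * (πstar s a - πk s a)) = 0 := by
      rw [← Finset.mul_sum, ← Finset.mul_sum, Finset.sum_sub_distrib, hπstarsum, hπksum]; ring
    rw [← add_zero (_ - _), ← hz]
    simp only [Finset.mul_sum, ← Finset.sum_add_distrib, ← Finset.sum_sub_distrib]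
    refine Finset.sum_congr rfl fun a _ => ?_
    have hc := hc a
    simp only at hc
    rw [hc]
    have ht : τ'⁻¹ * τ' = 1 := inv_mul_cancel₀ hτ'.ne'
    linear_combination (-τ'⁻¹ * (f' s a - τ' * (β⁻¹ * (1 + 2 * lamBar * ybar) * Qq s a
          - β⁻¹ * lamBar * Wω s a + τk⁻¹ * f s a))) * y1 s a
      - ((1 + 2 * lamBar * ybar) * β⁻¹ * (Qq s a - Q s a)) * y2 s a
      + (lamBar * β⁻¹ * (Wω s a - W s a)) * y2 s a
      + (νstar s * (πstar s a - πk s a) * (β⁻¹ * (1 + 2 * lamBar * ybar) * Qq s a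
          - β⁻¹ * lamBar * Wω s a + τk⁻¹ * f s a)) * ht
  obtain ⟨hl0, hlN⟩ := hlamBar
  have hb : 0 < β⁻¹ := inv_pos.mpr hβ
  have ht : 0 < τ'⁻¹ := inv_pos.mpr hτ'
  have hco : |1 + 2 * lamBar * ybar| ≤ 1 + 2 * M * N := by
    refine (abs_add_le _ _).trans ?_
    rw [abs_one, abs_mul, abs_of_nonneg (by positivity : 0 ≤ 2 * lamBar)]
    have := mul_le_mul hlN hybar (abs_nonneg _) hN.le
    linarith
  rw [key]
  refine (abs_sub _ _).trans (add_le_add ((abs_add_le _ _).trans (add_le_add ?_ ?_)) ?_)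
  · rw [abs_mul, abs_of_pos ht, mul_assoc _ ε₁]
    exact mul_le_mul_of_nonneg_left c1 ht.le
  · rw [abs_mul, abs_mul, abs_of_pos hb, mul_assoc _ ε₂]
    exact mul_le_mul (mul_le_mul_of_nonneg_right hco hb.le) c2 (abs_nonneg _) (by positivity)
  · rw [abs_mul, abs_mul, abs_of_pos hb, abs_of_nonneg hl0, mul_assoc _ ε₃]
    exact mul_le_mul (mul_le_mul_of_nonneg_right hlN hb.le) c3 (abs_nonneg _) (by positivity)
end

section
/- Let S, A be nonempty finite types, ν* a probability vector on S, τ, τ', β > 0, M, N > 0, R_b, R_c ≥ 0, λ̄ ∈ [0,N], ȳ ∈ ℝ with |ȳ| ≤ M. Let f, f', Q_q, W_ω, Q₀, W₀ : S → A → ℝ with |Q_q(s,a) − Q₀(s,a)| ≤ R_c and |W_ω(s,a) − W₀(s,a)| ≤ R_b for all (s,a). Suppose ∑_s ν*(s) · max_a (τ'⁻¹·f'(s,a) − β⁻¹·(1+2λ̄ȳ)·Q_q(s,a) + β⁻¹·λ̄·W_ω(s,a) − τ⁻¹·f(s,a))² ≤ ε. Define M̂ = 4·(1+2MN)²·∑_s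 ν*(s)·(max_a Q₀(s,a)² + R_c²) + 4·N²·∑_s ν*(s)·(max_a W₀(s,a)² + R_b²). Then ∑_s ν*(s) · max_a (τ'⁻¹·f'(s,a) − τ⁻¹·f(s,a))² ≤ 2ε + 2·β⁻²·M̂. -/
open BigOperators

/-- Lemma 4.6 (stepwise energy difference), finite state-action setting: if the
fitted energy `τ'⁻¹f'` is `ε`-close (in the `ν*`-weighted sup-norm-squared
sense) to the ideal target `β⁻¹(1+2λ̄ȳ)Q_q − β⁻¹λ̄W_ω + τ⁻¹f`, and the critic
networks stay within `R_c, R_b` of their initializations, then the stepwise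
energy difference is bounded by `2ε + 2β⁻²·M̂`. -/
theorem stmt_10 {S A : Type*} [Fintype S] [Fintype A] [Nonempty S] [Nonempty A]
    (νstar : S → ℝ) (hνnn : ∀ s, 0 ≤ νstar s) (hνsum : ∑ s, νstar s = 1)
    (τ τ' β M N : ℝ) (hτ : 0 < τ) (hτ' : 0 < τ') (hβ : 0 < β)
    (hM : 0 < M) (hN : 0 < N)
    (Rb Rc : ℝ) (hRb : 0 ≤ Rb) (hRc : 0 ≤ Rc)
    (lamBar : ℝ) (hlamBar : lamBar ∈ Set.Icc (0 : ℝ) N)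
    (ybar : ℝ) (hybar : |ybar| ≤ M)
    (f f' Qq Wω Q₀ W₀ : S → A → ℝ)
    (hQclose : ∀ s a, |Qq s a - Q₀ s a| ≤ Rc)
    (hWclose : ∀ s a, |Wω s a - W₀ s a| ≤ Rb)
    (ε : ℝ)
    (herr : ∑ s, νstar s * (Finset.univ.sup' Finset.univ_nonempty (fun a =>
      (τ'⁻¹ * f' s a - β⁻¹ * (1 + 2 * lamBar * ybar) * Qq s a
        + β⁻¹ * lamBar * Wω s a - τ⁻¹ * f s a) ^ 2)) ≤ ε)
    (Mhat : ℝ)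
    (hMhat : Mhat = 4 * (1 + 2 * M * N) ^ 2 * ∑ s, νstar s *
        ((Finset.univ.sup' Finset.univ_nonempty fun a => (Q₀ s a) ^ 2) + Rc ^ 2)
      + 4 * N ^ 2 * ∑ s, νstar s *
        ((Finset.univ.sup' Finset.univ_nonempty fun a => (W₀ s a) ^ 2) + Rb ^ 2)) :
    ∑ s, νstar s * (Finset.univ.sup' Finset.univ_nonempty (fun a =>
        (τ'⁻¹ * f' s a - τ⁻¹ * f s a) ^ 2))
      ≤ 2 * ε + 2 * β⁻¹ ^ 2 * Mhat := by
  obtain ⟨hl0, hlN⟩ := hlamBar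
  have hc : (1 + 2 * lamBar * ybar) ^ 2 ≤ (1 + 2 * M * N) ^ 2 := by
    have h1 : |lamBar * ybar| ≤ N * M := by
      rw [abs_mul, abs_of_nonneg hl0]
      exact mul_le_mul hlN hybar (abs_nonneg _) hN.le
    have h2 := abs_le.mp h1
    apply sq_le_sq'
    · linarith [h2.1]
    · linarith [h2.2]
  have hl : lamBar ^ 2 ≤ N ^ 2 := pow_le_pow_left₀ hl0 hlN 2
  have close : ∀ x y R : ℝ, |x - y| ≤ R → x ^ 2 ≤ 2 * (y ^ 2 + R ^ 2) := by
    intro x y R h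
    have h1 : (x - y) ^ 2 ≤ R ^ 2 := sq_le_sq' (abs_le.mp h).1 (abs_le.mp h).2
    nlinarith [sq_nonneg (x - 2 * y)]
  have key : ∀ s, (Finset.univ.sup' Finset.univ_nonempty (fun a =>
        (τ'⁻¹ * f' s a - τ⁻¹ * f s a) ^ 2)) ≤
      2 * (Finset.univ.sup' Finset.univ_nonempty (fun a =>
      (τ'⁻¹ * f' s a - β⁻¹ * (1 + 2 * lamBar * ybar) * Qq s a
        + β⁻¹ * lamBar * Wω s a - τ⁻¹ * f s a) ^ 2)) +
      2 * β⁻¹ ^ 2 * (4 * (1 + 2 * M * N) ^ 2 *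
        ((Finset.univ.sup' Finset.univ_nonempty fun a => (Q₀ s a) ^ 2) + Rc ^ 2)
      + 4 * N ^ 2 *
        ((Finset.univ.sup' Finset.univ_nonempty fun a => (W₀ s a) ^ 2) + Rb ^ 2)) := by
    intro s
    apply Finset.sup'_le
    intro a _
    have hE := Finset.le_sup' (fun a =>
      (τ'⁻¹ * f' s a - β⁻¹ * (1 + 2 * lamBar * ybar) * Qq s a
        + β⁻¹ * lamBar * Wω s a - τ⁻¹ * f s a) ^ 2) (Finset.mem_univ a)
    have hQ := Finset.le_sup' (fun a => (Q₀ s a) ^ 2) (Finset.mem_univ a)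
    have hW := Finset.le_sup' (fun a => (W₀ s a) ^ 2) (Finset.mem_univ a)
    have hQ1 := close _ _ _ (hQclose s a)
    have hW1 := close _ _ _ (hWclose s a)
    generalize (Finset.univ.sup' Finset.univ_nonempty (fun a =>
      (τ'⁻¹ * f' s a - β⁻¹ * (1 + 2 * lamBar * ybar) * Qq s a
        + β⁻¹ * lamBar * Wω s a - τ⁻¹ * f s a) ^ 2)) = E at hE ⊢
    generalize (Finset.univ.sup' Finset.univ_nonempty fun a => (Q₀ s a) ^ 2) = q at hQ ⊢
    generalize (Finset.univ.sup' Finset.univ_nonempty fun a => (W₀ s a) ^ 2) = w at hW ⊢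
    have hQ2 : (1 + 2 * lamBar * ybar) ^ 2 * Qq s a ^ 2 ≤
        (1 + 2 * M * N) ^ 2 * (2 * (q + Rc ^ 2)) :=
      mul_le_mul hc (by linarith) (sq_nonneg _) (sq_nonneg _)
    have hW2 : lamBar ^ 2 * Wω s a ^ 2 ≤ N ^ 2 * (2 * (w + Rb ^ 2)) :=
      mul_le_mul hl (by linarith) (sq_nonneg _) (sq_nonneg _)
    have htri : ∀ x y : ℝ, (x + y) ^ 2 ≤ 2 * x ^ 2 + 2 * y ^ 2 := fun x y => by
      nlinarith [sq_nonneg (x - y)]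
    have hy : ((1 + 2 * lamBar * ybar) * Qq s a - lamBar * Wω s a) ^ 2 ≤
        4 * (1 + 2 * M * N) ^ 2 * (q + Rc ^ 2) + 4 * N ^ 2 * (w + Rb ^ 2) := by
      have h5 := htri ((1 + 2 * lamBar * ybar) * Qq s a) (-(lamBar * Wω s a))
      rw [neg_sq, mul_pow, mul_pow, ← sub_eq_add_neg] at h5
      linarith
    have hy2 := mul_le_mul_of_nonneg_left hy (sq_nonneg β⁻¹)
    have h3 := htri (τ'⁻¹ * f' s a - β⁻¹ * (1 + 2 * lamBar * ybar) * Qq s a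
        + β⁻¹ * lamBar * Wω s a - τ⁻¹ * f s a)
      (β⁻¹ * ((1 + 2 * lamBar * ybar) * Qq s a - lamBar * Wω s a))
    rw [mul_pow β⁻¹] at h3
    have h4 : (τ'⁻¹ * f' s a - β⁻¹ * (1 + 2 * lamBar * ybar) * Qq s a
        + β⁻¹ * lamBar * Wω s a - τ⁻¹ * f s a) +
      (β⁻¹ * ((1 + 2 * lamBar * ybar) * Qq s a - lamBar * Wω s a))
      = τ'⁻¹ * f' s a - τ⁻¹ * f s a := by ring
    rw [h4] at h3
    linarith
  have hsum := Finset.sum_le_sum fun s (_ : s ∈ Finset.univ) =>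
    mul_le_mul_of_nonneg_left (key s) (hνnn s)
  refine hsum.trans ?_
  refine le_trans (le_of_eq ?_) (add_le_add_left (mul_le_mul_of_nonneg_left herr zero_le_two) _)
  rw [hMhat]
  simp only [mul_add, Finset.mul_sum, Finset.sum_add_distrib]
  simp only [← Finset.sum_add_distrib]
  refine Finset.sum_congr rfl fun s _ => ?_
  ring
end
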